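/- arXiv:0710.2625 — 4 statements merged into one kernel-verified Lean document; each statement's English description precedes it below -/
import Mathlib

section
/- Let Γ be an infinite discrete group and let βΓ be its Čech–Stone compactification, realized as the space of ultrafilters on Γ with the Stone topology and equipped with the semigroup operation defined by A ∈ p·q ⟺ {γ ∈ Γ : γ⁻¹A ∈ q} ∈ p. Then for every element p of the remainder βΓ \ Γ (i.e. every free ultrafilter p on Γ), the left multiplication map L_p : βΓ → βΓ, q ↦ p·q, is not Borel measurable (with respect to the Borel σ-algebras of the Stone topology on both sides). -/
/-- The Hindman–Strauss semigroup operation on `βΓ = Ultrafilter Γ`: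
`A ∈ p · q ↔ {γ | γ⁻¹ A ∈ q} ∈ p`. -/
def ultraMul {Γ : Type*} [Group Γ] (p q : Ultrafilter Γ) : Ultrafilter Γ :=
  p.bind fun γ => q.map fun γ' => γ * γ'

open Filter Topology Set in
lemma lm_generic_half {Γ : Type*} (p : Ultrafilter Γ) (hp : ∀ γ : Γ, p ≠ pure γ)
    (R V : Set (Γ → Bool)) (hR : R ∈ residual (Γ → Bool)) (hV : IsOpen V) (hne : V.Nonempty) :
    (∃ y ∈ R ∩ V, {γ | y γ = true} ∈ p) ∧ (∃ y ∈ R ∩ V, {γ | y γ = true} ∉ p) := by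
  classical
  obtain ⟨y0, hy0⟩ := hne
  obtain ⟨F, u, hu, huV⟩ := isOpen_pi_iff.1 hV y0 hy0
  let φ : (Γ → Bool) → (Γ → Bool) := fun y γ => if γ ∈ F then y γ else ! (y γ)
  have hφφ : ∀ y, φ (φ y) = y := by
    intro y; funext γ; by_cases h : γ ∈ F <;> simp [φ, h]
  have hφc : Continuous φ := by
    refine continuous_pi fun γ => ?_
    by_cases h : γ ∈ F
    · simpa [φ, h] using continuous_apply γ
    · simp only [φ, h, if_false]
      exact (continuous_of_discreteTopology (f := fun b : Bool => !b)).comp (continuous_apply γ)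
  let h : (Γ → Bool) ≃ₜ (Γ → Bool) :=
    { toFun := φ, invFun := φ, left_inv := hφφ, right_inv := hφφ,
      continuous_toFun := hφc, continuous_invFun := hφc }
  have hR' : φ ⁻¹' R ∈ residual (Γ → Bool) :=
    tendsto_residual_of_isOpenMap h.continuous h.isOpenMap hR
  have hd : Dense (R ∩ φ ⁻¹' R) := dense_of_mem_residual (inter_mem hR hR')
  have hUo : IsOpen ((F : Set Γ).pi u) := isOpen_set_pi F.finite_toSet fun a ha => (hu a ha).1
  obtain ⟨y, hyU, hyR, hyR'⟩ := hd.inter_open_nonempty _ hUo ⟨y0, fun a ha => (hu a ha).2⟩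
  have hyV : y ∈ V := huV hyU
  have hyV' : φ y ∈ V := by
    apply huV
    intro a ha
    have : φ y a = y a := by simp only [φ]; rw [if_pos (Finset.mem_coe.1 ha)]
    rw [this]; exact hyU a ha
  have hF : ((F : Set Γ))ᶜ ∈ p := by
    rw [Ultrafilter.compl_mem_iff_notMem]
    intro hF
    obtain ⟨γ, -, h⟩ := Ultrafilter.eq_pure_of_finite_mem F.finite_toSet hF
    exact hp γ h
  have key : {γ | φ y γ = true} ∈ p ↔ {γ | y γ = true} ∉ p := by
    rw [← Ultrafilter.compl_mem_iff_notMem]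
    constructor
    · intro h
      filter_upwards [h, hF] with γ h1 h2
      have h3 : γ ∉ F := h2
      simpa [φ, h3] using h1
    · intro h
      filter_upwards [h, hF] with γ h1 h2
      have h3 : γ ∉ F := h2
      simpa [φ, h3] using h1
  by_cases hy : {γ | y γ = true} ∈ p
  · exact ⟨⟨y, ⟨hyR, hyV⟩, hy⟩, ⟨φ y, ⟨hyR', hyV'⟩, fun h => key.1 h hy⟩⟩
  · exact ⟨⟨φ y, ⟨hyR', hyV'⟩, key.2 hy⟩, ⟨y, ⟨hyR, hyV⟩, hy⟩⟩

open Filter Topology Set in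
lemma lm_not_borel.{u} {Γ K : Type u} [TopologicalSpace K] [CompactSpace K]
    (p : Ultrafilter Γ) (hp : ∀ γ : Γ, p ≠ pure γ)
    (f : K → (Γ → Bool)) (hf : Continuous f) (hs : Function.Surjective f)
    (hB : @MeasurableSet K (borel K) {q | {γ | f q γ = true} ∈ p}) : False := by
  obtain ⟨E, hE, himg, hmin⟩ := exists_compact_surjective_zorn_subset hf hs
  let g : E → (Γ → Bool) := E.restrict f
  have hg : Continuous g := hf.comp continuous_subtype_val
  have hgs : Function.Surjective g := by
    intro y
    obtain ⟨x, hx, rfl⟩ : y ∈ f '' E := himg ▸ mem_univ y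
    exact ⟨⟨x, hx⟩, rfl⟩
  have hgB : @MeasurableSet E (borel E) {q | {γ | g q γ = true} ∈ p} := by
    have := (@Continuous.borel_measurable E K _ _ _ continuous_subtype_val) hB
    exact this
  -- open sets of fibres
  have hopen : ∀ t : Set E, IsOpen t → IsOpen (g '' tᶜ)ᶜ := by
    intro t ht
    exact (ht.isClosed_compl.isCompact.image hg).isClosed.isOpen_compl
  have hnon : ∀ t : Set E, IsOpen t → t.Nonempty → ((g '' tᶜ)ᶜ).Nonempty := by
    intro t ht hne
    have := hmin tᶜ (by simpa [Set.nonempty_iff_ne_empty] using hne) ht.isClosed_compl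
    rwa [nonempty_compl]
  have hres : ∀ D ∈ residual E, (g '' Dᶜ)ᶜ ∈ residual (Γ → Bool) := by
    intro D hD
    obtain ⟨S, hSo, hSd, hSc, hSD⟩ := mem_residual_iff.1 hD
    have : (⋂ t ∈ S, (g '' tᶜ)ᶜ) ∈ residual (Γ → Bool) := by
      rw [countable_bInter_mem hSc]
      intro t ht
      refine residual_of_dense_open (hopen t (hSo t ht)) ?_
      rw [dense_iff_inter_open]
      rintro W hW ⟨w, hw⟩
      obtain ⟨x, rfl⟩ := hgs w
      obtain ⟨z, hz⟩ := (hSd t ht).inter_open_nonempty _ (hW.preimage hg) ⟨x, hw⟩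
      obtain ⟨y, hy⟩ := hnon _ ((hW.preimage hg).inter (hSo t ht)) ⟨z, hz⟩
      obtain ⟨x', rfl⟩ := hgs y
      refine ⟨g x', ?_, ?_⟩
      · by_contra hc
        exact hy ⟨x', fun h => hc h.1, rfl⟩
      · rintro ⟨x'', h1, h2⟩
        exact hy ⟨x'', fun h => h1 h.2, h2⟩
    filter_upwards [this] with y hy
    rintro ⟨x, hx, rfl⟩
    apply hx
    apply hSD
    intro t ht
    by_contra hc
    exact (mem_iInter₂.1 hy t ht) ⟨x, hc, rfl⟩
  letI : MeasurableSpace E := borel E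
  haveI : BorelSpace E := ⟨rfl⟩
  obtain ⟨U, hU, hBU⟩ := hgB.residualEq_isOpen
  have hR := hres _ hBU
  have hRs : ∀ x : E, g x ∈ (g '' {x | ({q | {γ | g q γ = true} ∈ p} : Set E) x = U x}ᶜ)ᶜ →
      ({γ | g x γ = true} ∈ p ↔ x ∈ U) := by
    intro x hx
    by_contra hc
    apply hx
    refine ⟨x, fun h => hc ?_, rfl⟩
    exact iff_of_eq h
  by_cases hUe : U.Nonempty
  · obtain ⟨y, ⟨hy1, hy2⟩, hy3⟩ := (lm_generic_half p hp _ _ hR (hopen U hU) (hnon U hU hUe)).2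
    obtain ⟨x, rfl⟩ := hgs y
    refine hy3 ((hRs x hy1).2 ?_)
    by_contra hc
    exact hy2 ⟨x, hc, rfl⟩
  · obtain ⟨y, ⟨hy1, -⟩, hy3⟩ := (lm_generic_half p hp _ _ hR isOpen_univ univ_nonempty).1
    obtain ⟨x, rfl⟩ := hgs y
    exact hUe ⟨x, (hRs x hy1).1 hy3⟩

open Cardinal in
/-- A subset of an infinite group all of whose translates are independent. -/
lemma lm_exists_independent (Γ : Type*) [Group Γ] [Infinite Γ] :
    ∃ A : Set Γ, ∀ F G : Finset Γ, Disjoint F G →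
      ∃ x : Γ, (∀ γ ∈ F, γ * x ∈ A) ∧ (∀ γ ∈ G, γ * x ∉ A) := by
  classical
  let I := Finset Γ × Finset Γ
  have hI : #I = #Γ := by
    simp [I, Cardinal.mk_finset_of_infinite]
  obtain ⟨r, hr, hord⟩ := Cardinal.exists_ord_eq I
  let H : I → Finset Γ := fun i => i.1 ∪ i.2
  have step : ∀ (i : I) (x : ∀ j, r j i → Γ), ∃ z : Γ,
      ∀ j (hj : r j i), ∀ a ∈ H i, ∀ b ∈ H j, a * z ≠ b * x j hj := by
    intro i x
    let bad : Set Γ := ⋃ j : {j // r j i}, 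
      (fun ab : Γ × Γ => ab.1⁻¹ * (ab.2 * x j.1 j.2)) '' ((H i ×ˢ H j.1 : Finset (Γ × Γ)) : Set _)
    have hlt : #{j // r j i} < #Γ := by
      rw [← hI]
      exact Cardinal.card_typein_lt i hord
    have hfin : ∀ j : {j // r j i}, ((fun ab : Γ × Γ => ab.1⁻¹ * (ab.2 * x j.1 j.2)) ''
        ((H i ×ˢ H j.1 : Finset (Γ × Γ)) : Set _)).Finite :=
      fun j => (Finset.finite_toSet _).image _
    have hbad : #bad < #Γ := by
      rcases finite_or_infinite {j // r j i} with h | h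
      · exact lt_of_lt_of_le (Cardinal.lt_aleph0_iff_set_finite.2 (Set.finite_iUnion hfin))
          (Cardinal.aleph0_le_mk Γ)
      · refine lt_of_le_of_lt ?_ hlt
        refine (Cardinal.mk_iUnion_le _).trans ?_
        refine (mul_le_mul_right (ciSup_le' fun j =>
          (Cardinal.lt_aleph0_iff_set_finite.2 (hfin j)).le) _).trans ?_
        rw [Cardinal.mul_aleph0_eq (Cardinal.aleph0_le_mk _)]
    obtain ⟨z, hz⟩ : ∃ z, z ∉ bad := by
      by_contra! hc
      rw [Set.eq_univ_of_forall hc, Cardinal.mk_univ] at hbad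
      exact lt_irrefl _ hbad
    refine ⟨z, fun j hj a ha b hb hab => hz ?_⟩
    refine Set.mem_iUnion.2 ⟨⟨j, hj⟩, (a, b), by simp [ha, hb], ?_⟩
    simp [← hab]
  choose s hs using step
  let x : I → Γ := hr.wf.fix s
  have hx : ∀ i, x i = s i (fun j _ => x j) := fun i => hr.wf.fix_eq s i
  have hlt : ∀ i j, r j i → ∀ a ∈ H i, ∀ b ∈ H j, a * x i ≠ b * x j := by
    intro i j hj a ha b hb
    rw [hx i]
    exact hs i (fun j _ => x j) j hj a ha b hb
  refine ⟨{g | ∃ i : I, Disjoint i.1 i.2 ∧ ∃ a ∈ i.1, g = a * x i}, fun F G hFG =>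
    ⟨x (F, G), fun γ hγ => ⟨(F, G), hFG, γ, hγ, rfl⟩, ?_⟩⟩
  rintro γ hγ ⟨i, hi, a, ha, h⟩
  have h1 : γ ∈ H (F, G) := Finset.mem_union_right _ hγ
  have h2 : a ∈ H i := Finset.mem_union_left _ ha
  rcases trichotomous_of r i (F, G) with h3 | h3 | h3
  · exact hlt _ _ h3 _ h1 _ h2 h
  · subst h3
    have : γ = a := mul_right_cancel h
    subst this
    exact Finset.disjoint_left.1 hFG ha hγ
  · exact hlt _ _ h3 _ h2 _ h1 h.symm

/-- For an infinite discrete group `Γ` and any element `p` of the remainder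
`βΓ \ Γ` (i.e. any non-principal ultrafilter on `Γ`), the left multiplication
`L_p : βΓ → βΓ` is not Borel measurable (with respect to the Borel σ-algebras
of the Stone topology on `Ultrafilter Γ`). -/
theorem left_mul_not_borel_measurable (Γ : Type*) [Group Γ] [Infinite Γ]
    (p : Ultrafilter Γ) (hp : ∀ γ : Γ, p ≠ pure γ) :
    ¬ @Measurable (Ultrafilter Γ) (Ultrafilter Γ)
        (borel (Ultrafilter Γ)) (borel (Ultrafilter Γ))
        (fun q => ultraMul p q) := by
  classical
  intro hm
  obtain ⟨A, hA⟩ := lm_exists_independent Γ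
  let f : Ultrafilter Γ → (Γ → Bool) := fun q γ => decide ({x | γ * x ∈ A} ∈ q)
  refine lm_not_borel p hp f ?_ ?_ ?_
  · refine continuous_pi fun γ => ?_
    refine (continuous_bool_rng true).2 ?_
    have : (fun q : Ultrafilter Γ => f q γ) ⁻¹' {true} = {q | {x | γ * x ∈ A} ∈ q} := by
      ext q; simp [f]
    rw [this]
    exact ⟨ultrafilter_isClosed_basic _, ultrafilter_isOpen_basic _⟩
  · intro y
    let D : Γ → Set Γ := fun γ => {x | γ * x ∈ A ↔ y γ = true}
    obtain ⟨q, hq⟩ := Ultrafilter.exists_ultrafilter_of_finite_inter_nonempty (Set.range D) (by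
      intro T hT
      rw [← Set.image_univ, Finset.subset_set_image_iff] at hT
      obtain ⟨S, -, rfl⟩ := hT
      obtain ⟨x, h1, h2⟩ := hA (S.filter fun γ => y γ = true) (S.filter fun γ => ¬ y γ = true)
        (Finset.disjoint_filter_filter_not _ _ _)
      refine ⟨x, ?_⟩
      intro t ht
      simp only [Finset.coe_image, Set.mem_image] at ht
      obtain ⟨γ, hγ, rfl⟩ := ht
      have hγ : γ ∈ S := hγ
      by_cases hy : y γ = true
      · exact iff_of_true (h1 γ (by simp [hγ, hy])) hy
      · exact iff_of_false (h2 γ (by simp [hγ, hy])) hy)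
    refine ⟨q, funext fun γ => ?_⟩
    have hD : D γ ∈ q := hq ⟨γ, rfl⟩
    have : {x | γ * x ∈ A} ∈ q ↔ y γ = true := by
      constructor
      · intro h
        obtain ⟨x, h3, h4⟩ := q.nonempty_of_mem (Filter.inter_mem h hD)
        exact h4.1 h3
      · intro h
        filter_upwards [hD] with x hx
        exact hx.2 h
    rw [Bool.eq_iff_iff]
    simpa [f] using this
  · have h := hm (MeasurableSpace.measurableSet_generateFrom (ultrafilter_isOpen_basic A))
    convert h using 1
    ext q
    simp only [f, decide_eq_true_eq]
    rfl
end

section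
/- Let F be a free filter on ℕ, identified with the subset χ(F) = {1_A : A ∈ F} of Ω = {0,1}^ℕ, and let λ be the infinite product on Ω of the fair Bernoulli measure (½)(δ₀ + δ₁) on {0,1}. Then the inner measure of χ(F) is zero: λ_*(χ(F)) = 0, i.e. every λ-measurable subset of Ω contained in χ(F) has λ-measure 0. -/
open Filter MeasureTheory

/-- `χ(F) = {1_A : A ∈ F} ⊆ Ω = {0,1}^ℕ`, realized as `ℕ → Bool`. -/
def chiF (F : Filter ℕ) : Set (ℕ → Bool) := {ω | {n | ω n = true} ∈ F}

/-- Flip all coordinates outside the finite set `I`. -/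
def flipOff (I : Finset ℕ) (ω : ℕ → Bool) : ℕ → Bool := fun n => if n ∈ I then ω n else !(ω n)

lemma flipOff_flipOff (I : Finset ℕ) (ω : ℕ → Bool) : flipOff I (flipOff I ω) = ω := by
  funext n
  by_cases h : n ∈ I <;> simp [flipOff, h]

lemma measurable_flipOff (I : Finset ℕ) : Measurable (flipOff I) := by
  refine measurable_pi_lambda _ fun n => ?_
  by_cases h : n ∈ I
  · simpa [flipOff, h] using measurable_pi_apply n
  · simp only [flipOff, h, if_false]
    exact (measurable_of_countable (fun b : Bool => !b)).comp (measurable_pi_apply n)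

lemma map_flipOff (lam : Measure (ℕ → Bool)) [IsProbabilityMeasure lam]
    (hlam : ∀ (s : Finset ℕ) (f : ℕ → Bool),
      lam {ω | ∀ n ∈ s, ω n = f n} = (1 / 2 : ENNReal) ^ s.card) (I : Finset ℕ) :
    lam.map (flipOff I) = lam := by
  have key : ∀ s : Finset ℕ, (lam.map (flipOff I)).map s.restrict = lam.map s.restrict := by
    intro s
    refine Measure.ext_of_singleton fun a => ?_
    let f : ℕ → Bool := fun n => if h : n ∈ s then a ⟨n, h⟩ else false
    have e1 : (s.restrict : (ℕ → Bool) → _) ⁻¹' {a} = {ω | ∀ n ∈ s, ω n = f n} := by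
      ext ω
      simp only [Set.mem_preimage, Set.mem_singleton_iff, Set.mem_ofPred_eq, funext_iff,
        Subtype.forall, f]
      refine forall₂_congr fun n hn => ?_
      simp [hn]
    have e2 : flipOff I ⁻¹' {ω | ∀ n ∈ s, ω n = f n} = {ω | ∀ n ∈ s, ω n = flipOff I f n} := by
      ext ω
      simp only [Set.mem_preimage, Set.mem_ofPred_eq]
      refine forall₂_congr fun n hn => ?_
      by_cases h : n ∈ I
      · simp [flipOff, h]
      · simp only [flipOff, h, if_false]
        cases ω n <;> cases f n <;> simp
    have hm : Measurable (s.restrict : (ℕ → Bool) → _) := s.measurable_restrict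
    have hms := hm (MeasurableSet.singleton a)
    rw [Measure.map_apply hm (MeasurableSet.singleton a),
      Measure.map_apply hm (MeasurableSet.singleton a),
      Measure.map_apply (measurable_flipOff I) hms, e1, e2, hlam, hlam]
  have (s : Finset ℕ) : IsFiniteMeasure (lam.map (s.restrict : (ℕ → Bool) → _)) := inferInstance
  exact IsProjectiveLimit.unique (P := fun s : Finset ℕ => lam.map s.restrict) key (fun s => rfl)

/-- Let `λ` be the product on `Ω = {0,1}^ℕ` of the fair Bernoulli measure
`½(δ₀ + δ₁)` (characterized as the probability measure giving each cylinder
prescribed on a finite set `s` of coordinates the measure `(1/2)^|s|`).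
For a free filter `F` on `ℕ`, the inner measure of `χ(F)` is zero: every
`λ`-measurable subset of `Ω` contained in `χ(F)` has `λ`-measure `0`. -/
theorem free_filter_inner_measure_zero (F : Filter ℕ) (hF : F.NeBot)
    (hfree : ⋂₀ {A : Set ℕ | A ∈ F} = ∅)
    (lam : Measure (ℕ → Bool)) [IsProbabilityMeasure lam]
    (hlam : ∀ (s : Finset ℕ) (f : ℕ → Bool),
      lam {ω | ∀ n ∈ s, ω n = f n} = (1 / 2 : ENNReal) ^ s.card) :
    ∀ B : Set (ℕ → Bool), B ⊆ chiF F → NullMeasurableSet B lam → lam B = 0 := by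
  intro B hB hBn
  obtain ⟨C, hCB, hCm, hCe⟩ := hBn.exists_measurable_subset_ae_eq
  rw [← measure_congr hCe]
  by_contra hne
  obtain ⟨V, hV, hlt⟩ := exists_measure_symmDiff_lt_of_generateFrom_isSetRing (μ := lam)
    (isSetRing_measurableCylinders (α := fun _ : ℕ => Bool))
    ⟨{Set.univ}, Set.countable_singleton _, Set.singleton_subset_iff.2 (univ_mem_measurableCylinders _), by simp⟩
    generateFrom_measurableCylinders.symm hCm (ENNReal.half_pos hne)
  obtain ⟨I, S, hS, rfl⟩ := (mem_measurableCylinders _).mp hV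
  set V : Set (ℕ → Bool) := cylinder (α := fun _ : ℕ => Bool) I S with hVdef
  have hVm : MeasurableSet V := MeasurableSet.of_mem_measurableCylinders hV
  have hflipV : ∀ ω, ω ∈ V → flipOff I ω ∈ V := by
    intro ω hω
    rw [hVdef, mem_cylinder] at hω ⊢
    convert hω using 1
    funext n
    simp [flipOff]
  have hcof : ∀ n, ({n}ᶜ : Set ℕ) ∈ F := by
    intro n
    have hn : n ∉ ⋂₀ {A : Set ℕ | A ∈ F} := by rw [hfree]; simp
    simp only [Set.mem_sInter, Set.mem_ofPred_eq, not_forall] at hn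
    obtain ⟨A, hA, hnA⟩ := hn
    exact mem_of_superset hA fun m hm h => hnA (by rw [Set.mem_singleton_iff] at h; rwa [← h])
  have hIc : (⋂ n ∈ I, ({n}ᶜ : Set ℕ)) ∈ F := (biInter_finset_mem I).2 fun n _ => hcof n
  have hflipC : ∀ ω, ω ∈ C → flipOff I ω ∉ C := by
    intro ω h1 h2
    have h1' : {n | ω n = true} ∈ F := hB (hCB h1)
    have h2' : {n | flipOff I ω n = true} ∈ F := hB (hCB h2)
    obtain ⟨n, ⟨hn1, hn2⟩, hn3⟩ := hF.nonempty_of_mem (inter_mem (inter_mem h1' h2') hIc)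
    have hnI : n ∉ I := by
      intro h
      simp only [Set.mem_iInter] at hn3
      exact hn3 n h rfl
    simp only [Set.mem_ofPred_eq] at hn1 hn2
    simp [flipOff, hnI, hn1] at hn2
  have hle : lam (C ∩ V) ≤ lam (V \ C) := by
    have : C ∩ V ⊆ flipOff I ⁻¹' (V \ C) := fun ω hω => ⟨hflipV ω hω.2, hflipC ω hω.1⟩
    refine (measure_mono this).trans ?_
    rw [← Measure.map_apply (measurable_flipOff I) (hVm.diff hCm), map_flipOff lam hlam I]
  have h1 : lam (V \ C) ≤ lam (symmDiff V C) := measure_mono fun x hx => Or.inl hx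
  have h2 : lam (C \ V) ≤ lam (symmDiff V C) := measure_mono fun x hx => Or.inr hx
  have h3 : lam C < lam C := by
    calc lam C = lam (C ∩ V) + lam (C \ V) := (measure_inter_add_diff C hVm).symm
      _ ≤ lam (symmDiff V C) + lam (symmDiff V C) := add_le_add (hle.trans h1) h2
      _ < lam C / 2 + lam C / 2 := ENNReal.add_lt_add hlt hlt
      _ = lam C := ENNReal.add_halves _
  exact lt_irrefl _ h3
end

section
/- Let F be a free filter on ℕ, identified with the subset χ(F) = {1_A : A ∈ F} of Ω = {0,1}^ℕ, and let λ be the infinite product on Ω of the fair Bernoulli measure (½)(δ₀ + δ₁) on {0,1}. Then the outer measure of χ(F) is either 0 or 1: λ*(χ(F)) ∈ {0, 1}. -/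
open Filter MeasureTheory

/-- Cylinder over the finite set `s` prescribed by `f`. -/
def cylF (s : Finset ℕ) (f : ℕ → Bool) : Set (ℕ → Bool) := {ω | ∀ n ∈ s, ω n = f n}

/-- Flip the coordinate `a`. -/
def flipAt (a : ℕ) (ω : ℕ → Bool) : ℕ → Bool := fun n => if n = a then !ω n else ω n

lemma flipAt_invol (a : ℕ) : Function.Involutive (flipAt a) := by
  intro ω
  funext n
  by_cases h : n = a <;> simp [flipAt, h]

lemma measurable_flipAt (a : ℕ) : Measurable (flipAt a) := by
  refine measurable_pi_iff.2 fun n => ?_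
  by_cases h : n = a
  · simp only [flipAt, h, if_true]
    exact (measurable_of_countable (fun b : Bool => !b)).comp (measurable_pi_apply a)
  · simp only [flipAt, h, if_false]
    exact measurable_pi_apply n

lemma measurableSet_cylF (s : Finset ℕ) (f : ℕ → Bool) : MeasurableSet (cylF s f) := by
  have : cylF s f = ⋂ n ∈ s, (fun ω : ℕ → Bool => ω n) ⁻¹' {f n} := by
    ext ω; simp [cylF]
  rw [this]
  exact Finset.measurableSet_biInter s fun n _ =>
    measurable_pi_apply n (measurableSet_singleton (f n))

lemma flipAt_preimage_cylF (a : ℕ) (s : Finset ℕ) (f : ℕ → Bool) :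
    flipAt a ⁻¹' cylF s f = cylF s (flipAt a f) := by
  ext ω
  simp only [cylF, Set.mem_preimage, Set.mem_setOf_eq]
  refine forall₂_congr fun n _ => ?_
  by_cases h : n = a
  · subst h
    simp only [flipAt, if_true]
    cases ω n <;> cases f n <;> simp
  · simp [flipAt, h]

lemma ext_cylF (μ ν : Measure (ℕ → Bool)) [IsFiniteMeasure μ]
    (h : ∀ s f, μ (cylF s f) = ν (cylF s f)) : μ = ν := by
  refine ext_of_generate_finite {S | ∃ s f, S = cylF s f} ?_ ?_ ?_ ?_
  · apply le_antisymm
    · refine iSup_le fun n => ?_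
      rw [← measurable_iff_comap_le]
      refine @measurable_to_bool _ (MeasurableSpace.generateFrom _) _ ?_
      refine MeasurableSpace.measurableSet_generateFrom ⟨{n}, fun _ => true, ?_⟩
      ext ω; simp [cylF]
    · refine MeasurableSpace.generateFrom_le ?_
      rintro _ ⟨s, f, rfl⟩
      exact measurableSet_cylF s f
  · rintro _ ⟨s, f, rfl⟩ _ ⟨t, g, rfl⟩ ⟨ω, h1, h2⟩
    refine ⟨s ∪ t, ω, ?_⟩
    ext x
    simp only [cylF, Set.mem_inter_iff, Set.mem_setOf_eq, Finset.mem_union] at *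
    grind
  · rintro _ ⟨s, f, rfl⟩
    exact h s f
  · have := h ∅ (fun _ => true)
    simpa [cylF] using this

/-- A flip-invariant measure is a multiple of the Bernoulli measure on cylinders. -/
lemma cylF_of_invariant (ν : Measure (ℕ → Bool))
    (h : ∀ a s f, ν (cylF s (flipAt a f)) = ν (cylF s f)) (s : Finset ℕ) :
    ∀ f, ν (cylF s f) = (1 / 2 : ENNReal) ^ s.card * ν Set.univ := by
  induction s using Finset.induction_on with
  | empty => intro f; simp [cylF]
  | insert a s ha ih =>
    intro f
    have hU : cylF s f = cylF (insert a s) f ∪ cylF (insert a s) (flipAt a f) := by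
      ext ω
      simp only [cylF, flipAt, Set.mem_union, Set.mem_setOf_eq, Finset.mem_insert,
        forall_eq_or_imp, if_true]
      have : (∀ n ∈ s, ω n = if n = a then !f n else f n) ↔ ∀ n ∈ s, ω n = f n := by
        refine forall₂_congr fun n hn => ?_
        have : n ≠ a := fun e => ha (e ▸ hn)
        simp [this]
      rw [this]
      cases ω a <;> cases f a <;> simp
    have hd : Disjoint (cylF (insert a s) f) (cylF (insert a s) (flipAt a f)) := by
      rw [Set.disjoint_left]
      intro ω h1 h2
      have e1 := h1 a (Finset.mem_insert_self _ _)
      have e2 := h2 a (Finset.mem_insert_self _ _)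
      rw [e1] at e2
      simp [flipAt] at e2
    have e := ih f
    rw [hU, measure_union hd (measurableSet_cylF _ _), h, ← two_mul] at e
    rw [Finset.card_insert_of_notMem ha, pow_succ', mul_assoc, ← e, ← mul_assoc, one_div,
      ENNReal.inv_mul_cancel (by simp) (by simp), one_mul]

/-- Let `λ` be the product on `Ω = {0,1}^ℕ` of the fair Bernoulli measure
`½(δ₀ + δ₁)` (characterized as the probability measure giving each cylinder
prescribed on a finite set `s` of coordinates the measure `(1/2)^|s|`).
For a free filter `F` on `ℕ`, the outer measure of `χ(F)` (in Mathlib, a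
measure applied to an arbitrary set is the induced outer measure) is `0`
or `1`. -/
theorem free_filter_outer_measure_zero_or_one (F : Filter ℕ) (hF : F.NeBot)
    (hfree : ⋂₀ {A : Set ℕ | A ∈ F} = ∅)
    (lam : Measure (ℕ → Bool)) [IsProbabilityMeasure lam]
    (hlam : ∀ (s : Finset ℕ) (f : ℕ → Bool),
      lam {ω | ∀ n ∈ s, ω n = f n} = (1 / 2 : ENNReal) ^ s.card) :
    lam (chiF F) = 0 ∨ lam (chiF F) = 1 := by
  have hc : ∀ s f, lam (cylF s f) = (1 / 2 : ENNReal) ^ s.card := hlam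
  have hinv : ∀ a, lam.map (flipAt a) = lam := by
    intro a
    haveI : IsFiniteMeasure (lam.map (flipAt a)) := Measure.isFiniteMeasure_map _ _
    refine ext_cylF _ _ fun s f => ?_
    rw [Measure.map_apply (measurable_flipAt a) (measurableSet_cylF s f),
      flipAt_preimage_cylF, hc, hc]
  have hpre : ∀ a (A : Set (ℕ → Bool)), lam (flipAt a ⁻¹' A) = lam A := by
    intro a A
    let e : (ℕ → Bool) ≃ᵐ (ℕ → Bool) :=
      ⟨(flipAt_invol a).toPerm, measurable_flipAt a, measurable_flipAt a⟩
    have h := e.map_apply (μ := lam) A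
    change lam.map (flipAt a) A = lam (flipAt a ⁻¹' A) at h
    rw [← h, hinv]
  have hS : ∀ a, flipAt a ⁻¹' chiF F = chiF F := by
    intro a
    have ha : ∀ᶠ n in F, n ≠ a := by
      have : a ∉ ⋂₀ {A : Set ℕ | A ∈ F} := by simp [hfree]
      simp only [Set.mem_sInter, Set.mem_setOf_eq, not_forall] at this
      obtain ⟨A, hA, haA⟩ := this
      filter_upwards [hA] with n hn e
      exact haA (e ▸ hn)
    ext ω
    change (∀ᶠ n in F, flipAt a ω n = true) ↔ ∀ᶠ n in F, ω n = true
    refine eventually_congr ?_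
    filter_upwards [ha] with n hn
    simp [flipAt, hn]
  have hν : ∀ a s f, lam.restrict (chiF F) (cylF s (flipAt a f)) =
      lam.restrict (chiF F) (cylF s f) := by
    intro a s f
    rw [Measure.restrict_apply (measurableSet_cylF _ _),
      Measure.restrict_apply (measurableSet_cylF _ _), ← hpre a (cylF s f ∩ chiF F),
      Set.preimage_inter, hS, flipAt_preimage_cylF]
  have key : lam.restrict (chiF F) = lam (chiF F) • lam := by
    refine ext_cylF _ _ fun s f => ?_
    rw [cylF_of_invariant _ hν s f, Measure.smul_apply, hc, smul_eq_mul, mul_comm,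
      Measure.restrict_apply_univ]
  have h2 := congrArg (fun m => m (toMeasurable lam (chiF F))) key
  simp only [Measure.smul_apply, smul_eq_mul, measure_toMeasurable] at h2
  rw [Measure.restrict_apply (measurableSet_toMeasurable _ _),
    Set.inter_eq_right.2 (subset_toMeasurable _ _)] at h2
  by_cases h0 : lam (chiF F) = 0
  · exact Or.inl h0
  · right
    have h3 : lam (chiF F) * 1 = lam (chiF F) * lam (chiF F) := by rw [mul_one]; exact h2
    exact ((ENNReal.mul_right_inj h0 (measure_ne_top _ _)).1 h3).symm
end

section
/- Let Γ be an infinite group acting on the product space Ω = {0,1}^Γ by the shift action (γω)(γ′) = ω(γ⁻¹γ′). Then there exists a point ω₀ ∈ Ω whose Γ-orbit {γω₀ : γ ∈ Γ} is dense in Ω with respect to the product topology. -/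
universe u

open Cardinal in
theorem shift_exists_avoid {Γ : Type u} {I : Type u} [Infinite Γ] (s : Set I)
    (hs : #s < #Γ) (B : I → Set Γ) (hB : ∀ i, (B i).Finite) :
    ∃ x, ∀ j ∈ s, x ∉ B j := by
  have key : #(⋃ j ∈ s, B j : Set Γ) < #Γ := by
    by_cases hf : s.Finite
    · have : (⋃ j ∈ s, B j).Finite := hf.biUnion (fun i _ => hB i)
      exact (Cardinal.lt_aleph0_iff_set_finite.2 this).trans_le (Cardinal.aleph0_le_mk Γ)
    · have h0 : ℵ₀ ≤ #s := by
        rw [← not_lt, Cardinal.lt_aleph0_iff_set_finite]; exact hf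
      refine lt_of_le_of_lt ?_ hs
      refine (Cardinal.mk_biUnion_le _ _).trans ?_
      refine (mul_le_mul_right (ciSup_le' (a := ℵ₀) fun i => ?_) _).trans ?_
      · exact (Cardinal.lt_aleph0_iff_set_finite.2 (hB _)).le
      · exact (Cardinal.mul_aleph0_eq h0).le
  by_contra! h
  refine key.ne ?_
  have : (⋃ j ∈ s, B j) = Set.univ := by
    ext x
    simpa using h x
  rw [this, Cardinal.mk_univ]

open Cardinal in
theorem shift_exists_seq {Γ : Type u} [Group Γ] [Infinite Γ] :
    ∃ h : Finset Γ × Finset Γ → Γ, ∀ i j, i ≠ j → ∀ f ∈ i.1, ∀ f' ∈ j.1,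
      h i * f ≠ h j * f' := by
  classical
  obtain ⟨r, wo, hr⟩ := Cardinal.ord_eq (Finset Γ × Finset Γ)
  have hc : #(Finset Γ × Finset Γ) = #Γ := by
    rw [Cardinal.mk_prod, Cardinal.mk_finset_of_infinite, Cardinal.lift_id,
      Cardinal.mul_eq_self (Cardinal.aleph0_le_mk Γ)]
  have hlt : ∀ i, #{j | r j i} < #Γ := by
    intro i
    have := Cardinal.card_typein_lt (r := r) i hr
    rw [hc] at this
    exact this
  have ex : ∀ (i : Finset Γ × Finset Γ) (g : ∀ j, r j i → Γ), ∃ x : Γ,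
      ∀ j (hj : r j i), ∀ f ∈ i.1, ∀ f' ∈ j.1, x * f ≠ g j hj * f' := by
    intro i g
    obtain ⟨x, hx⟩ := shift_exists_avoid {j | r j i} (hlt i)
      (fun j => if hj : r j i then
        ((i.1 ×ˢ j.1).image (fun p => g j hj * p.2 * p.1⁻¹) : Finset Γ) else (∅ : Set Γ))
      (by intro j; split_ifs
          · exact Finset.finite_toSet _
          · exact Set.finite_empty)
    refine ⟨x, fun j hj f hf f' hf' e => hx j hj ?_⟩
    rw [dif_pos hj]
    refine Finset.mem_coe.2 (Finset.mem_image.2 ⟨(f, f'), Finset.mem_product.2 ⟨hf, hf'⟩, ?_⟩)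
    simp [← e]
  choose G hG using ex
  have wf : WellFounded r := IsWellFounded.wf
  have main : ∀ i j, r j i → ∀ f ∈ i.1, ∀ f' ∈ j.1, wf.fix G i * f ≠ wf.fix G j * f' := by
    intro i j hj f hf f' hf'
    rw [wf.fix_eq G i]
    exact hG i (fun y _ => wf.fix G y) j hj f hf f' hf'
  refine ⟨wf.fix G, fun i j hij f hf f' hf' => ?_⟩
  rcases trichotomous_of r i j with h | h | h
  · exact (main j i h f' hf' f hf).symm
  · exact absurd h hij
  · exact main i j h f hf f' hf'

/-- Let `Γ` be an infinite group acting on `Ω = {0,1}^Γ` (realized as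
`Γ → Bool` with the product topology) by the shift `(γω)(γ′) = ω(γ⁻¹γ′)`.
Then there is a point `ω₀ ∈ Ω` whose `Γ`-orbit is dense in `Ω`. -/
theorem exists_dense_orbit_shift (Γ : Type*) [Group Γ] [Infinite Γ] :
    ∃ ω₀ : Γ → Bool,
      Dense (Set.range fun γ : Γ => (fun γ' => ω₀ (γ⁻¹ * γ') : Γ → Bool)) := by
  classical
  obtain ⟨h, hh⟩ := shift_exists_seq (Γ := Γ)
  refine ⟨fun x => decide (∃ i, ∃ f ∈ i.1, f ∈ i.2 ∧ x = h i * f), ?_⟩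
  rw [dense_iff_inter_open]
  rintro U hU ⟨ω, hω⟩
  obtain ⟨F, u, hu, hsub⟩ := isOpen_pi_iff.1 hU ω hω
  refine ⟨_, hsub ?_, ⟨(h (F, F.filter (fun f => ω f = true)))⁻¹, rfl⟩⟩
  intro f hf
  have hf' : f ∈ F := hf
  convert (hu f hf').2 using 1
  rw [Bool.eq_iff_iff, decide_eq_true_iff, inv_inv]
  constructor
  · rintro ⟨j, f', hj, hj2, e⟩
    by_cases hij : (F, F.filter (fun f => ω f = true)) = j
    · subst hij
      have := mul_left_cancel e
      subst this
      exact (Finset.mem_filter.1 hj2).2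
    · exact absurd e (hh _ _ hij f hf' f' hj)
  · intro hw
    exact ⟨_, f, hf', Finset.mem_filter.2 ⟨hf', hw⟩, rfl⟩
end
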